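/- arXiv:2402.06399 — 2 statements merged into one kernel-verified Lean document; each statement's English description precedes it below -/
import Mathlib

section
/- Let G be a finite group and let U : G → B(H) be a map into the bounded operators on a complex Hilbert space H. Then U is a commutative unitary representation (a unitary representation such that U(s)U(t) = U(t)U(s) for all s, t ∈ G) if and only if there exist k ∈ ℕ, orthogonal projections P₁, …, P_k ∈ B(H) (each self-adjoint and idempotent) with P_i P_j = 0 for i ≠ j, and scalars λ_i(s) ∈ ℂ with |λ_i(s)| = 1 for 1 ≤ i ≤ k and s ∈ G, such that: (1) P₁ + ⋯ + P_k = I_H; (2) U(s) = ∑_{i=1}^{k} λ_i(s) P_i for all s ∈ G; and (3) λ_i(st) = λ_i(s)λ_i(t) for all s, t ∈ G and 1 ≤ i ≤ k. -/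
/-- A unitary representation of a group `G` on a complex Hilbert space `H`: every `U(s)` is a
unitary operator, `U(e) = I`, and `U(st) = U(s)U(t)`. -/
def IsUnitaryRep {G : Type*} [Group G] {H : Type*} [NormedAddCommGroup H]
    [InnerProductSpace ℂ H] [CompleteSpace H] (U : G → H →L[ℂ] H) : Prop :=
  (∀ s : G, U s ∈ unitary (H →L[ℂ] H)) ∧ U 1 = 1 ∧ ∀ s t : G, U (s * t) = U s * U t

open scoped ComplexConjugate

section CharacterProjection

variable {K A : Type*} [CommGroup K] [Ring A] [Algebra ℂ A]

theorem AddChar.apply_ofMul_mul (χ : AddChar (Additive K) ℂ) (s t : K) :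
    χ (.ofMul (s * t)) = χ (.ofMul s) * χ (.ofMul t) :=
  χ.map_add_eq_mul _ _

theorem AddChar.apply_ofMul_one (χ : AddChar (Additive K) ℂ) : χ (.ofMul (1 : K)) = 1 :=
  χ.map_zero_eq_one

variable [Fintype K]

/-- The spectral projection onto the `χ`-isotypic part of a representation of a finite commutative
group `K` in a complex algebra. -/
noncomputable def characterProjection (R : K →* A) (χ : AddChar (Additive K) ℂ) : A :=
  (Fintype.card K : ℂ)⁻¹ • ∑ s : K, χ (.ofMul s⁻¹) • R s

theorem mul_characterProjection (R : K →* A) (χ : AddChar (Additive K) ℂ) (t : K) :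
    R t * characterProjection R χ = χ (.ofMul t) • characterProjection R χ := by
  simp only [characterProjection, mul_smul_comm, Finset.mul_sum, smul_comm (χ (.ofMul t)),
    Finset.smul_sum (r := χ (.ofMul t))]
  congr 1
  refine Fintype.sum_equiv (Equiv.mulLeft t) _ _ fun s ↦ ?_
  simp only [Equiv.coe_mulLeft, smul_smul, ← χ.apply_ofMul_mul, map_mul R, mul_inv_rev,
    inv_mul_cancel_right]

theorem characterProjection_mul (R : K →* A) (χ : AddChar (Additive K) ℂ) (t : K) :
    characterProjection R χ * R t = χ (.ofMul t) • characterProjection R χ := by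
  rw [← mul_characterProjection]
  simp only [characterProjection, smul_mul_assoc, mul_smul_comm, Finset.mul_sum, Finset.sum_mul,
    ← map_mul, mul_comm t]

theorem isIdempotentElem_characterProjection (R : K →* A) (χ : AddChar (Additive K) ℂ) :
    IsIdempotentElem (characterProjection R χ) := by
  rw [IsIdempotentElem]
  nth_rw 1 [characterProjection]
  simp only [smul_mul_assoc, Finset.sum_mul, mul_characterProjection, smul_smul,
    ← χ.apply_ofMul_mul, inv_mul_cancel, χ.apply_ofMul_one, one_smul, Finset.sum_const,
    Finset.card_univ, ← Nat.cast_smul_eq_nsmul ℂ]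
  rw [inv_mul_cancel₀ (Nat.cast_ne_zero.2 Fintype.card_ne_zero), one_smul]

theorem characterProjection_mul_of_ne (R : K →* A) {χ ψ : AddChar (Additive K) ℂ} (h : χ ≠ ψ) :
    characterProjection R χ * characterProjection R ψ = 0 := by
  obtain ⟨t, ht⟩ := DFunLike.ne_iff.1 h
  have key : (χ t - ψ t) • (characterProjection R χ * characterProjection R ψ) = 0 := by
    rw [sub_smul, ← smul_mul_assoc, ← mul_smul_comm, sub_eq_zero]
    exact (congrArg (· * characterProjection R ψ) (characterProjection_mul R χ t.toMul)).symm.trans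
      ((mul_assoc _ _ _).trans
        (congrArg (characterProjection R χ * ·) (mul_characterProjection R ψ t.toMul)))
  exact (smul_eq_zero_iff_right (sub_ne_zero.2 ht)).1 key

theorem sum_characterProjection (R : K →* A) : ∑ χ, characterProjection R χ = 1 := by
  classical
  simp only [characterProjection, ← Finset.smul_sum]
  rw [Finset.sum_comm]
  simp only [← Finset.sum_smul, AddChar.sum_apply_eq_ite]
  have h (s : K) : (Additive.ofMul s⁻¹ = 0) = (s = 1) := by
    rw [ofMul_eq_zero, inv_eq_one]
  simp only [h, ite_smul, zero_smul, Finset.sum_ite_eq', Finset.mem_univ, if_true, map_one]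
  rw [smul_smul, Fintype.card_congr (Additive.toMul (α := K)),
    inv_mul_cancel₀ (Nat.cast_ne_zero.2 Fintype.card_ne_zero), one_smul]

theorem isSelfAdjoint_characterProjection [StarRing A] [StarModule ℂ A] (R : K →* A)
    (hR : ∀ s, star (R s) = R s⁻¹) (χ : AddChar (Additive K) ℂ) :
    IsSelfAdjoint (characterProjection R χ) := by
  simp only [IsSelfAdjoint, characterProjection, star_smul, star_sum, hR]
  congr 1
  · simp
  refine Fintype.sum_equiv (Equiv.inv K) _ _ fun s ↦ ?_
  rw [Equiv.inv_apply, inv_inv, ofMul_inv, AddChar.map_neg_eq_conj]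
  simp

theorem eq_sum_characterProjection (R : K →* A) (s : K) :
    R s = ∑ χ : AddChar (Additive K) ℂ, χ (.ofMul s) • characterProjection R χ := by
  simp only [← mul_characterProjection, ← Finset.mul_sum, sum_characterProjection, mul_one]

end CharacterProjection

theorem sum_smul_mul_sum_smul {ι A : Type*} [Fintype ι] [Ring A] [Algebra ℂ A] {P : ι → A}
    (hP : ∀ i, IsIdempotentElem (P i)) (hPP : ∀ i j, i ≠ j → P i * P j = 0) (a b : ι → ℂ) :
    (∑ i, a i • P i) * ∑ i, b i • P i = ∑ i, (a i * b i) • P i := by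
  rw [Finset.sum_mul]
  refine Finset.sum_congr rfl fun i _ ↦ ?_
  rw [Finset.mul_sum, Finset.sum_eq_single i]
  · rw [smul_mul_smul_comm, (hP i).eq]
  · intro j _ hj
    rw [smul_mul_smul_comm, hPP i j hj.symm, smul_zero]
  · simp

theorem stmt13 {G : Type*} [Group G] [Finite G] {H : Type*} [NormedAddCommGroup H]
    [InnerProductSpace ℂ H] [CompleteSpace H] (U : G → H →L[ℂ] H) :
    (IsUnitaryRep U ∧ ∀ s t : G, U s * U t = U t * U s) ↔
      ∃ (k : ℕ) (P : Fin k → H →L[ℂ] H) (lam : Fin k → G → ℂ),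
        (∀ i, IsSelfAdjoint (P i)) ∧ (∀ i, IsIdempotentElem (P i)) ∧
        (∀ i j, i ≠ j → P i * P j = 0) ∧
        (∀ i s, ‖lam i s‖ = 1) ∧
        (∑ i, P i) = 1 ∧
        (∀ s, U s = ∑ i, lam i s • P i) ∧
        (∀ i (s t : G), lam i (s * t) = lam i s * lam i t) := by
  constructor
  · rintro ⟨⟨hU, h1, hmul⟩, hcomm⟩
    let V : G →* unitary (H →L[ℂ] H) :=
      { toFun := fun s ↦ ⟨U s, hU s⟩
        map_one' := Subtype.ext h1
        map_mul' := fun s t ↦ Subtype.ext (hmul s t) }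
    let : CommGroup V.range :=
      { (inferInstance : Group V.range) with
        mul_comm := by
          rintro ⟨_, s, rfl⟩ ⟨_, t, rfl⟩
          exact Subtype.ext (Subtype.ext (hcomm s t)) }
    have : Finite V.range := Finite.of_surjective _ V.rangeRestrict_surjective
    have : Fintype V.range := Fintype.ofFinite _
    let R : V.range →* (H →L[ℂ] H) := (unitary (H →L[ℂ] H)).subtype.comp V.range.subtype
    have hR (s : V.range) : star (R s) = R s⁻¹ := rfl
    let e := (Fintype.equivFin (AddChar (Additive V.range) ℂ)).symm
    refine ⟨_, fun i ↦ characterProjection R (e i), fun i s ↦ e i (.ofMul (V.rangeRestrict s)),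
      fun i ↦ isSelfAdjoint_characterProjection R hR _,
      fun i ↦ isIdempotentElem_characterProjection R _,
      fun i j hij ↦ characterProjection_mul_of_ne R (e.injective.ne hij),
      fun i s ↦ AddChar.norm_apply _ _, ?_, fun s ↦ ?_, fun i s t ↦ ?_⟩
    · rw [e.sum_comp (characterProjection R), sum_characterProjection]
    · rw [e.sum_comp fun χ ↦ χ (.ofMul (V.rangeRestrict s)) • characterProjection R χ]
      exact eq_sum_characterProjection R (V.rangeRestrict s)
    · simp only [map_mul V.rangeRestrict, AddChar.apply_ofMul_mul]
  · rintro ⟨k, P, lam, hsa, hid, horth, hnorm, hsum, hU, hlam⟩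
    have hlam1 (i) : lam i 1 = 1 := by
      have h0 : lam i 1 ≠ 0 := norm_ne_zero_iff.1 (by simp [hnorm])
      have h := hlam i 1 1
      rw [mul_one] at h
      exact (mul_eq_left₀ h0).1 h.symm
    have hstar (s) : star (U s) = ∑ i, conj (lam i s) • P i := by
      simp only [hU, star_sum, star_smul, (hsa _).star_eq, starRingEnd_apply]
    refine ⟨⟨fun s ↦ Unitary.mem_iff.2 ⟨?_, ?_⟩, ?_, fun s t ↦ ?_⟩, fun s t ↦ ?_⟩
    · rw [hstar, hU, sum_smul_mul_sum_smul hid horth]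
      simp [Complex.conj_mul', hnorm, hsum]
    · rw [hstar, hU, sum_smul_mul_sum_smul hid horth]
      simp [Complex.mul_conj', hnorm, hsum]
    · simp [hU, hlam1, hsum]
    · simp only [hU, sum_smul_mul_sum_smul hid horth, hlam]
    · simp only [hU, sum_smul_mul_sum_smul hid horth, mul_comm]
end

section
/- Let U : G → B(H) be a unitary representation of a group G on a complex Hilbert space H and let n ≥ 1 be a natural number. Then the map U_n : G → B(H), s ↦ U(s)ⁿ, is a unitary representation (equivalently, U(st)ⁿ = U(s)ⁿ U(t)ⁿ for all s, t ∈ G) if and only if U(g) = I_H for every g in the subgroup G_n of G generated by the set { s^{-(n-1)} (ts)^{n-1} t^{-(n-1)} : s, t ∈ G }. -/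
/-- A homomorphism `φ` satisfies `φ (s * t) ^ (k + 1) = φ s ^ (k + 1) * φ t ^ (k + 1)` exactly
when it kills every `s⁻ᵏ (ts)ᵏ t⁻ᵏ`. -/
theorem MonoidHom.map_mul_pow_succ_iff {G K : Type*} [Group G] [Group K] (φ : G →* K) (k : ℕ)
    (s t : G) :
    φ (s * t) ^ (k + 1) = φ s ^ (k + 1) * φ t ^ (k + 1) ↔
      φ (s ^ (-(k : ℤ)) * (t * s) ^ (k : ℤ) * t ^ (-(k : ℤ))) = 1 := by
  have h : φ (s * t) ^ (k + 1) = φ s * φ (t * s) ^ k * φ t := by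
    have hc : SemiconjBy (φ s) (φ (t * s)) (φ (s * t)) := by
      simp [SemiconjBy, mul_assoc]
    rw [(hc.pow_right k).eq, mul_assoc, ← map_mul, pow_succ]
  rw [h, pow_succ' (φ s), pow_succ (φ t)]
  simp only [map_mul, map_inv, map_pow, zpow_neg, zpow_natCast]
  rw [mul_inv_eq_one, inv_mul_eq_iff_eq_mul]
  simp only [← mul_assoc, mul_left_inj]
  simp only [mul_assoc, mul_right_inj]

theorem stmt15 {G : Type*} [Group G] {H : Type*} [NormedAddCommGroup H]
    [InnerProductSpace ℂ H] [CompleteSpace H] (U : G → H →L[ℂ] H)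
    (hU : IsUnitaryRep U) (n : ℕ) (hn : 1 ≤ n) :
    IsUnitaryRep (fun s => U s ^ n) ↔
      ∀ g ∈ Subgroup.closure {g : G | ∃ s t : G,
          g = s ^ (-((n : ℤ) - 1)) * (t * s) ^ ((n : ℤ) - 1) * t ^ (-((n : ℤ) - 1))},
        U g = 1 := by
  obtain ⟨hunit, hone, hmul⟩ := hU
  obtain ⟨k, rfl⟩ := Nat.exists_eq_add_of_le' hn
  let V : G →* H →L[ℂ] H := { toFun := U, map_one' := hone, map_mul' := hmul }
  let φ : G →* (H →L[ℂ] H)ˣ := V.toHomUnits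
  have hφ (g : G) : (φ g : H →L[ℂ] H) = U g := rfl
  have hk : ((k + 1 : ℕ) : ℤ) - 1 = k := by simp
  have hker (g : G) : U g = 1 ↔ g ∈ φ.ker := by
    rw [MonoidHom.mem_ker, ← hφ, Units.val_eq_one]
  have hpow (s t : G) : U (s * t) ^ (k + 1) = U s ^ (k + 1) * U t ^ (k + 1) ↔
      U (s ^ (-(k : ℤ)) * (t * s) ^ (k : ℤ) * t ^ (-(k : ℤ))) = 1 := by
    rw [hker, MonoidHom.mem_ker, ← φ.map_mul_pow_succ_iff, Units.ext_iff]
    simp only [Units.val_pow_eq_pow_val, Units.val_mul, hφ]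
  rw [hk]
  constructor
  · rintro ⟨-, -, h⟩ g hg
    rw [hker]
    refine (Subgroup.closure_le φ.ker).2 ?_ hg
    rintro _ ⟨s, t, rfl⟩
    exact (hker _).1 ((hpow s t).1 (h s t))
  · intro h
    refine ⟨fun s => pow_mem (hunit s) _, by simp [hone], fun s t => ?_⟩
    exact (hpow s t).2 (h _ (Subgroup.subset_closure ⟨s, t, rfl⟩))
end
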